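/- arXiv:1711.03767 — 2 statements merged into one kernel-verified Lean document; each statement's English description precedes it below -/
import Mathlib

section
/- Let p ≥ 2 and ω > 0, let (U(t,s))_{t≥s≥0} be an exponentially stable ω-periodic evolution family on Lᵖ(Ω,H) with constants M > 0, a > 0, and let h : ℝ≥0 → Lᵖ(Ω,H) be a continuous bounded process with lim_{t→∞} E‖h(t+ω) − h(t)‖ᵖ = 0. Then the function F(t) = ∫₀ᵗ U(t,s) h(s) ds satisfies lim_{t→∞} E‖F(t+ω) − F(t)‖ᵖ = 0; together with boundedness and continuity of F, the process F is p-mean S-asymptotically ω-periodic. -/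
open MeasureTheory Filter Set

noncomputable section

section LpNorm

variable {Ω : Type*} [MeasurableSpace Ω] {μ : Measure Ω}
  {H : Type*} [NormedAddCommGroup H] {p : ℝ}

theorem integral_norm_rpow_coe_Lp (hp : 0 < p) (f : Lp H (ENNReal.ofReal p) μ) :
    ∫ w, ‖f w‖ ^ p ∂μ = ‖f‖ ^ p := by
  have hnonneg : 0 ≤ ∫ w, ‖f w‖ ^ p ∂μ := integral_nonneg fun w => by positivity
  rw [Lp.norm_def, (Lp.memLp f).eLpNorm_eq_integral_rpow_norm (by simpa using hp)
    ENNReal.ofReal_ne_top, ENNReal.toReal_ofReal hp.le,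
    ENNReal.toReal_ofReal (by positivity), Real.rpow_inv_rpow hnonneg hp.ne']

theorem integral_norm_sub_rpow_coe_Lp (hp : 0 < p) (f g : Lp H (ENNReal.ofReal p) μ) :
    ∫ w, ‖f w - g w‖ ^ p ∂μ = ‖f - g‖ ^ p := by
  rw [← integral_norm_rpow_coe_Lp hp]
  refine integral_congr_ae ?_
  filter_upwards [Lp.coeFn_sub f g] with w hw
  rw [hw, Pi.sub_apply]

theorem tendsto_norm_rpow_zero_iff {ι E : Type*} [SeminormedAddCommGroup E] (hp : 0 < p)
    {l : Filter ι} {f : ι → E} :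
    Tendsto (fun i => ‖f i‖ ^ p) l (nhds 0) ↔ Tendsto f l (nhds 0) := by
  rw [tendsto_zero_iff_norm_tendsto_zero (f := f)]
  constructor
  · intro hf
    have := hf.rpow_const (p := p⁻¹) (Or.inr (by positivity))
    simpa [Real.rpow_rpow_inv (norm_nonneg _) hp.ne', Real.zero_rpow (inv_pos.2 hp).ne']
      using this
  · intro hf
    simpa [Real.zero_rpow hp.ne'] using hf.rpow_const (p := p) (Or.inr hp.le)

end LpNorm

section Evolution

variable {E : Type*} [NormedAddCommGroup E] [NormedSpace ℝ E]
  {U : ℝ → ℝ → E →L[ℝ] E} {k : ℝ → E} {M a C : ℝ}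

theorem continuousOn_evolution_apply
    (hU_cont : ∀ x, ContinuousOn (fun q : ℝ × ℝ => U q.1 q.2 x) {q | 0 ≤ q.2 ∧ q.2 < q.1})
    (hU_le : ∀ s t : ℝ, 0 ≤ s → s ≤ t → ‖U t s‖ ≤ M)
    (hk : ContinuousOn k (Ici 0)) :
    ContinuousOn (fun q : ℝ × ℝ => U q.1 q.2 (k q.2)) {q | 0 ≤ q.2 ∧ q.2 < q.1} := by
  intro q₀ hq₀
  have hk₀ : Tendsto (fun q : ℝ × ℝ => k q.2 - k q₀.2)
      (nhdsWithin q₀ {q | 0 ≤ q.2 ∧ q.2 < q.1}) (nhds 0) := by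
    have hc : ContinuousWithinAt (fun q : ℝ × ℝ => k q.2) {q | 0 ≤ q.2 ∧ q.2 < q.1} q₀ :=
      (hk q₀.2 hq₀.1).comp continuous_snd.continuousWithinAt fun q hq => hq.1
    simpa using hc.tendsto.sub_const (k q₀.2)
  have hsmall : Tendsto (fun q : ℝ × ℝ => U q.1 q.2 (k q.2 - k q₀.2))
      (nhdsWithin q₀ {q | 0 ≤ q.2 ∧ q.2 < q.1}) (nhds 0) := by
    refine squeeze_zero_norm' (a := fun q : ℝ × ℝ => M * ‖k q.2 - k q₀.2‖) ?_
      (by simpa using hk₀.norm.const_mul M)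
    filter_upwards [self_mem_nhdsWithin] with q hq
    exact (U q.1 q.2).le_of_opNorm_le (hU_le _ _ hq.1 hq.2.le) _
  have hsum := hsmall.add (hU_cont (k q₀.2) q₀ hq₀)
  simpa [ContinuousWithinAt] using hsum

theorem continuousOn_evolution_apply_right
    (hU_cont : ∀ x, ContinuousOn (fun q : ℝ × ℝ => U q.1 q.2 x) {q | 0 ≤ q.2 ∧ q.2 < q.1})
    (hU_le : ∀ s t : ℝ, 0 ≤ s → s ≤ t → ‖U t s‖ ≤ M)
    (hk : ContinuousOn k (Ici 0)) (t : ℝ) :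
    ContinuousOn (fun r => U t r (k r)) (Ico 0 t) :=
  (continuousOn_evolution_apply hU_cont hU_le hk).comp (f := fun r => (t, r))
    (by fun_prop) fun _ hr => hr

theorem norm_evolution_apply_le (hC : ∀ r ≥ 0, ‖k r‖ ≤ C)
    (hU_le : ∀ s t : ℝ, 0 ≤ s → s ≤ t → ‖U t s‖ ≤ M) {r t : ℝ} (hr : 0 ≤ r) (hrt : r ≤ t) :
    ‖U t r (k r)‖ ≤ M * C :=
  (U t r).le_of_opNorm_le_of_le (hU_le r t hr hrt) (hC r hr)

theorem intervalIntegrable_evolution_apply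
    (hU_cont : ∀ x, ContinuousOn (fun q : ℝ × ℝ => U q.1 q.2 x) {q | 0 ≤ q.2 ∧ q.2 < q.1})
    (hU_le : ∀ s t : ℝ, 0 ≤ s → s ≤ t → ‖U t s‖ ≤ M)
    (hk : ContinuousOn k (Ici 0)) (hC : ∀ r ≥ 0, ‖k r‖ ≤ C) {t : ℝ} (ht : 0 ≤ t) :
    IntervalIntegrable (fun r => U t r (k r)) volume 0 t := by
  rw [intervalIntegrable_iff_integrableOn_Ico_of_le ht]
  refine IntegrableOn.of_bound (C := M * C) (by simp)
    ((continuousOn_evolution_apply_right hU_cont hU_le hk t).aestronglyMeasurable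
      measurableSet_Ico) ?_
  filter_upwards [ae_restrict_mem measurableSet_Ico] with r hr
  exact norm_evolution_apply_le hC hU_le hr.1 hr.2.le

theorem tendsto_integral_evolution_apply
    (hU_cont : ∀ x, ContinuousOn (fun q : ℝ × ℝ => U q.1 q.2 x) {q | 0 ≤ q.2 ∧ q.2 < q.1})
    (hU_le : ∀ s t : ℝ, 0 ≤ s → s ≤ t → ‖U t s‖ ≤ M)
    (hk : ContinuousOn k (Ici 0)) (hC : ∀ r ≥ 0, ‖k r‖ ≤ C) {s : ℝ} (hs : 0 ≤ s) :
    Tendsto (fun t => ∫ r in (0 : ℝ)..t, U t r (k r)) (nhdsWithin s (Ici 0))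
      (nhds (∫ r in (0 : ℝ)..s, U s r (k r))) := by
  have hMC : 0 ≤ M * C := (norm_nonneg _).trans
    (norm_evolution_apply_le hC hU_le le_rfl le_rfl : ‖U 0 0 (k 0)‖ ≤ M * C)
  have hext : ∀ t, 0 ≤ t → t ≤ s + 1 → ∫ r in (0 : ℝ)..t, U t r (k r) =
      ∫ r in Ico 0 (s + 1), (Ico 0 t).indicator (fun r => U t r (k r)) r := by
    intro t ht hts
    rw [intervalIntegral.integral_of_le ht, ← integral_Ico_eq_integral_Ioc,
      setIntegral_indicator measurableSet_Ico,
      inter_eq_self_of_subset_right (Ico_subset_Ico_right hts)]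
  rw [hext s hs (by linarith)]
  have hlt : ∀ᶠ t in nhdsWithin s (Ici 0), t < s + 1 :=
    mem_nhdsWithin_of_mem_nhds (Iio_mem_nhds (by linarith))
  refine Tendsto.congr' (f₁ := fun t => ∫ r in Ico 0 (s + 1),
    (Ico 0 t).indicator (fun r => U t r (k r)) r) ?_ ?_
  · filter_upwards [hlt, self_mem_nhdsWithin] with t ht ht0
    exact (hext t ht0 ht.le).symm
  refine tendsto_integral_filter_of_dominated_convergence (fun _ => M * C) ?_ ?_
    (integrable_const _) ?_
  · refine Eventually.of_forall fun t => AEStronglyMeasurable.restrict ?_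
    rw [aestronglyMeasurable_indicator_iff measurableSet_Ico]
    exact (continuousOn_evolution_apply_right hU_cont hU_le hk t).aestronglyMeasurable
      measurableSet_Ico
  · refine Eventually.of_forall fun t => Eventually.of_forall fun r => ?_
    by_cases hr : r ∈ Ico 0 t
    · rw [indicator_of_mem hr]
      exact norm_evolution_apply_le hC hU_le hr.1 hr.2.le
    · rwa [indicator_of_notMem hr, norm_zero]
  · filter_upwards [ae_restrict_mem measurableSet_Ico,
      ae_restrict_of_ae (Measure.ae_ne volume s)] with r hr hrs
    rcases lt_or_gt_of_ne hrs with hrs | hrs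
    · have hmem : Ioi r ∈ nhds s := Ioi_mem_nhds hrs
      have hcont : ContinuousOn (fun t => U t r (k r)) (Ioi r) :=
        (hU_cont (k r)).comp (f := fun t => (t, r)) (by fun_prop) fun t ht => ⟨hr.1, ht⟩
      rw [indicator_of_mem (show r ∈ Ico 0 s from ⟨hr.1, hrs⟩)]
      refine Tendsto.congr' ?_
        (((hcont.continuousAt hmem).tendsto).mono_left nhdsWithin_le_nhds)
      filter_upwards [mem_nhdsWithin_of_mem_nhds hmem] with t ht
      rw [indicator_of_mem (show r ∈ Ico 0 t from ⟨hr.1, ht⟩)]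
    · refine tendsto_const_nhds.congr' ?_
      filter_upwards [mem_nhdsWithin_of_mem_nhds (Iio_mem_nhds hrs)] with t ht
      rw [indicator_of_notMem fun h => hrs.not_gt h.2, indicator_of_notMem fun h => ht.not_gt h.2]

theorem integral_eq_integral_Ioi_indicator (f : ℝ → E) {t : ℝ} (ht : 0 ≤ t) :
    ∫ r in (0 : ℝ)..t, f r = ∫ u in Ioi (0 : ℝ), (Ioc 0 t).indicator (fun u => f (t - u)) u := by
  rw [setIntegral_indicator measurableSet_Ioc, inter_eq_self_of_subset_right Ioc_subset_Ioi_self,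
    ← intervalIntegral.integral_of_le ht, intervalIntegral.integral_comp_sub_left]
  simp

theorem integrableOn_Ioi_const_mul_exp (c : ℝ) (ha : 0 < a) :
    IntegrableOn (fun u => c * Real.exp (-a * u)) (Ioi 0) :=
  (exp_neg_integrableOn_Ioi 0 ha).const_mul c

theorem norm_indicator_evolution_apply_le
    (hU_bound : ∀ s t : ℝ, 0 ≤ s → s ≤ t → ‖U t s‖ ≤ M * Real.exp (-a * (t - s)))
    (hM : 0 ≤ M) (hC : ∀ r ≥ 0, ‖k r‖ ≤ C) (t u : ℝ) :
    ‖(Ioc 0 t).indicator (fun u => U t (t - u) (k (t - u))) u‖ ≤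
      M * C * Real.exp (-a * u) := by
  have hC0 : 0 ≤ C := (norm_nonneg _).trans (hC 0 le_rfl)
  by_cases hu : u ∈ Ioc 0 t
  · rw [indicator_of_mem hu]
    have h0 : 0 ≤ t - u := sub_nonneg.2 hu.2
    have := (U t (t - u)).le_of_opNorm_le_of_le
      (hU_bound (t - u) t h0 (by linarith [hu.1])) (hC _ h0)
    rw [sub_sub_cancel] at this
    linarith
  · rw [indicator_of_notMem hu, norm_zero]
    positivity

theorem norm_integral_evolution_apply_le
    (hU_bound : ∀ s t : ℝ, 0 ≤ s → s ≤ t → ‖U t s‖ ≤ M * Real.exp (-a * (t - s)))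
    (hM : 0 ≤ M) (ha : 0 < a) (hC : ∀ r ≥ 0, ‖k r‖ ≤ C) {t : ℝ} (ht : 0 ≤ t) :
    ‖∫ r in (0 : ℝ)..t, U t r (k r)‖ ≤ ∫ u in Ioi (0 : ℝ), M * C * Real.exp (-a * u) := by
  rw [integral_eq_integral_Ioi_indicator _ ht]
  exact norm_integral_le_of_norm_le (integrableOn_Ioi_const_mul_exp _ ha)
    (Eventually.of_forall (norm_indicator_evolution_apply_le hU_bound hM hC t))

theorem tendsto_integral_evolution_apply_zero
    (hU_cont : ∀ x, ContinuousOn (fun q : ℝ × ℝ => U q.1 q.2 x) {q | 0 ≤ q.2 ∧ q.2 < q.1})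
    (hU_le : ∀ s t : ℝ, 0 ≤ s → s ≤ t → ‖U t s‖ ≤ M)
    (hU_bound : ∀ s t : ℝ, 0 ≤ s → s ≤ t → ‖U t s‖ ≤ M * Real.exp (-a * (t - s)))
    (hM : 0 ≤ M) (ha : 0 < a) (hk : ContinuousOn k (Ici 0)) (hC : ∀ r ≥ 0, ‖k r‖ ≤ C)
    (hk0 : Tendsto k atTop (nhds 0)) :
    Tendsto (fun t => ∫ r in (0 : ℝ)..t, U t r (k r)) atTop (nhds 0) := by
  refine Tendsto.congr' (f₁ := fun t => ∫ u in Ioi (0 : ℝ),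
    (Ioc 0 t).indicator (fun u => U t (t - u) (k (t - u))) u) ?_ ?_
  · filter_upwards [eventually_ge_atTop 0] with t ht
    exact (integral_eq_integral_Ioi_indicator (fun r => U t r (k r)) ht).symm
  rw [← integral_zero ℝ E (μ := volume.restrict (Ioi 0))]
  refine tendsto_integral_filter_of_dominated_convergence
    (fun u => M * C * Real.exp (-a * u)) ?_ ?_ (integrableOn_Ioi_const_mul_exp _ ha) ?_
  · refine Eventually.of_forall fun t => AEStronglyMeasurable.restrict ?_
    rw [aestronglyMeasurable_indicator_iff measurableSet_Ioc]
    refine ContinuousOn.aestronglyMeasurable ?_ measurableSet_Ioc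
    exact (continuousOn_evolution_apply_right hU_cont hU_le hk t).comp (f := fun u => t - u)
      (by fun_prop) fun u hu => ⟨sub_nonneg.2 hu.2, sub_lt_self t hu.1⟩
  · exact Eventually.of_forall fun t => Eventually.of_forall
      (norm_indicator_evolution_apply_le hU_bound hM hC t)
  · filter_upwards [ae_restrict_mem measurableSet_Ioi] with u (hu : 0 < u)
    have hku : Tendsto (fun t => k (t - u)) atTop (nhds 0) :=
      hk0.comp (tendsto_atTop_add_const_right _ (-u) tendsto_id)
    refine squeeze_zero_norm' (a := fun t => M * ‖k (t - u)‖) ?_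
      (by simpa using hku.norm.const_mul M)
    filter_upwards [eventually_ge_atTop u] with t ht
    rw [indicator_of_mem (show u ∈ Ioc 0 t from ⟨hu, ht⟩)]
    exact (U t (t - u)).le_of_opNorm_le (hU_le _ _ (by linarith) (by linarith)) _

theorem integral_evolution_add_period_sub {ω : ℝ} (hω : 0 ≤ ω)
    (hU_cont : ∀ x, ContinuousOn (fun q : ℝ × ℝ => U q.1 q.2 x) {q | 0 ≤ q.2 ∧ q.2 < q.1})
    (hU_le : ∀ s t : ℝ, 0 ≤ s → s ≤ t → ‖U t s‖ ≤ M)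
    (hU_per : ∀ s t : ℝ, 0 ≤ s → s ≤ t → U (t + ω) (s + ω) = U t s)
    (hk : ContinuousOn k (Ici 0)) (hC : ∀ r ≥ 0, ‖k r‖ ≤ C) {t : ℝ} (ht : 0 ≤ t) :
    (∫ r in (0 : ℝ)..(t + ω), U (t + ω) r (k r)) - ∫ r in (0 : ℝ)..t, U t r (k r) =
      (∫ r in (0 : ℝ)..ω, U (t + ω) r (k r)) +
        ∫ r in (0 : ℝ)..t, U t r (k (r + ω) - k r) := by
  have hint : IntervalIntegrable (fun r => U (t + ω) r (k r)) volume 0 (t + ω) :=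
    intervalIntegrable_evolution_apply hU_cont hU_le hk hC (by linarith)
  have hωmem : ω ∈ uIcc 0 (t + ω) := by
    rw [uIcc_of_le (by linarith)]; exact ⟨hω, by linarith⟩
  have hint₁ := hint.mono_set (uIcc_subset_uIcc_left hωmem)
  have hint₂ := hint.mono_set (uIcc_subset_uIcc_right hωmem)
  have hkω : ContinuousOn (fun r => k (r + ω)) (Ici 0) :=
    hk.comp (by fun_prop) fun r (hr : 0 ≤ r) => add_nonneg hr hω
  have hshift : ∫ r in ω..(t + ω), U (t + ω) r (k r) =
      ∫ r in (0 : ℝ)..t, U t r (k (r + ω)) := by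
    have hsub := intervalIntegral.integral_comp_add_right (a := 0) (b := t)
      (fun r => U (t + ω) r (k r)) ω
    rw [zero_add] at hsub
    rw [← hsub]
    refine intervalIntegral.integral_congr fun r hr => ?_
    rw [uIcc_of_le ht] at hr
    simp only [hU_per r t hr.1 hr.2]
  simp only [map_sub]
  rw [← intervalIntegral.integral_add_adjacent_intervals hint₁ hint₂, hshift,
    intervalIntegral.integral_sub
      (intervalIntegrable_evolution_apply hU_cont hU_le hkω
        (fun r hr => hC _ (add_nonneg hr hω)) ht)
      (intervalIntegrable_evolution_apply hU_cont hU_le hk hC ht), add_sub_assoc]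

theorem tendsto_integral_evolution_add_period_sub {ω : ℝ} (hω : 0 ≤ ω)
    (hU_cont : ∀ x, ContinuousOn (fun q : ℝ × ℝ => U q.1 q.2 x) {q | 0 ≤ q.2 ∧ q.2 < q.1})
    (hU_le : ∀ s t : ℝ, 0 ≤ s → s ≤ t → ‖U t s‖ ≤ M)
    (hU_bound : ∀ s t : ℝ, 0 ≤ s → s ≤ t → ‖U t s‖ ≤ M * Real.exp (-a * (t - s)))
    (hU_per : ∀ s t : ℝ, 0 ≤ s → s ≤ t → U (t + ω) (s + ω) = U t s)
    (hM : 0 ≤ M) (ha : 0 < a) (hk : ContinuousOn k (Ici 0)) (hC : ∀ r ≥ 0, ‖k r‖ ≤ C)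
    (hk_per : Tendsto (fun t => k (t + ω) - k t) atTop (nhds 0)) :
    Tendsto (fun t => (∫ r in (0 : ℝ)..(t + ω), U (t + ω) r (k r)) -
      ∫ r in (0 : ℝ)..t, U t r (k r)) atTop (nhds 0) := by
  have hC0 : 0 ≤ C := (norm_nonneg _).trans (hC 0 le_rfl)
  have hinit : Tendsto (fun t => ∫ r in (0 : ℝ)..ω, U (t + ω) r (k r)) atTop (nhds 0) := by
    have hexp : Tendsto (fun t : ℝ => Real.exp (-a * t)) atTop (nhds 0) :=
      Real.tendsto_exp_atBot.comp (tendsto_id.const_mul_atTop_of_neg (neg_neg_of_pos ha))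
    refine squeeze_zero_norm' (a := fun t => M * C * ω * Real.exp (-a * t)) ?_
      (by simpa using hexp.const_mul (M * C * ω))
    filter_upwards [eventually_ge_atTop 0] with t ht
    have hle : ∀ r ∈ uIoc 0 ω, ‖U (t + ω) r (k r)‖ ≤ M * Real.exp (-a * t) * C := by
      intro r hr
      rw [uIoc_of_le hω] at hr
      refine (U (t + ω) r).le_of_opNorm_le_of_le
        ((hU_bound r (t + ω) hr.1.le (by linarith [hr.2])).trans ?_) (hC r hr.1.le)
      gcongr M * Real.exp ?_
      nlinarith [hr.2]
    have hnorm := intervalIntegral.norm_integral_le_of_norm_le_const hle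
    rw [sub_zero, abs_of_nonneg hω] at hnorm
    linarith
  have hdiff : Tendsto (fun t => ∫ r in (0 : ℝ)..t, U t r (k (r + ω) - k r)) atTop (nhds 0) := by
    refine tendsto_integral_evolution_apply_zero (k := fun r => k (r + ω) - k r) (C := C + C)
      hU_cont hU_le hU_bound hM ha ?_ ?_ hk_per
    · exact (hk.comp (by fun_prop) fun r (hr : 0 ≤ r) => add_nonneg hr hω).sub hk
    · exact fun r hr => norm_sub_le_of_le (hC _ (add_nonneg hr hω)) (hC r hr)
  have hsum := hinit.add hdiff
  rw [add_zero] at hsum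
  refine hsum.congr' ?_
  filter_upwards [eventually_ge_atTop 0] with t ht
  exact (integral_evolution_add_period_sub hω hU_cont hU_le hU_per hk hC ht).symm

end Evolution

/-- For an exponentially stable `ω`-periodic evolution family `U` on `Lᵖ(Ω,H)` and a
continuous bounded process `h` with `lim_{t→∞} E‖h(t+ω) − h(t)‖ᵖ = 0`, the function
`F t = ∫₀ᵗ U(t,s) h(s) ds` satisfies `lim_{t→∞} E‖F(t+ω) − F(t)‖ᵖ = 0`; together with
boundedness and continuity, `F` is `p`-mean `S`-asymptotically `ω`-periodic. -/
theorem convolution_with_SAP_forcing_is_SAP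
    {Ω : Type*} [MeasurableSpace Ω] {μ : Measure Ω} [IsProbabilityMeasure μ]
    {H : Type*} [NormedAddCommGroup H] [InnerProductSpace ℝ H] [CompleteSpace H]
    [SecondCountableTopology H]
    (p : ℝ) (hp : 2 ≤ p) [Fact (1 ≤ ENNReal.ofReal p)]
    (ω : ℝ) (hω : 0 < ω) (M a : ℝ) (hM : 0 < M) (ha : 0 < a)
    -- `U` is an exponentially stable `ω`-periodic evolution family on `Lᵖ(Ω,H)`:
    (U : ℝ → ℝ → (Lp H (ENNReal.ofReal p) μ →L[ℝ] Lp H (ENNReal.ofReal p) μ))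
    (hU_comp : ∀ r s t : ℝ, 0 ≤ r → r ≤ s → s ≤ t →
      ∀ x, U t s (U s r x) = U t r x)
    (hU_id : ∀ t : ℝ, 0 ≤ t → ∀ x, U t t x = x)
    (hU_cont : ∀ x : Lp H (ENNReal.ofReal p) μ,
      ContinuousOn (fun q : ℝ × ℝ => U q.1 q.2 x) {q : ℝ × ℝ | 0 ≤ q.2 ∧ q.2 < q.1})
    (hU_per : ∀ s t : ℝ, 0 ≤ s → s ≤ t → U (t + ω) (s + ω) = U t s)
    (hU_bound : ∀ s t : ℝ, 0 ≤ s → s ≤ t → ‖U t s‖ ≤ M * Real.exp (-a * (t - s)))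
    -- `h` is a continuous bounded process with `lim_{t→∞} E‖h(t+ω) − h(t)‖ᵖ = 0`:
    (h : ℝ → Lp H (ENNReal.ofReal p) μ)
    (hhcont : ∀ s ≥ (0:ℝ), Tendsto (fun t => ∫ w, ‖h t w - h s w‖ ^ p ∂μ)
      (nhdsWithin s (Ici 0)) (nhds 0))
    (hhbdd : ∃ C, ∀ t ≥ (0:ℝ), (∫ w, ‖h t w‖ ^ p ∂μ) ≤ C)
    (hhper : Tendsto (fun t => ∫ w, ‖h (t + ω) w - h t w‖ ^ p ∂μ) atTop (nhds 0)) :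
    -- conclusion: `F t = ∫₀ᵗ U(t,s) h(s) ds` is p-mean S-asymptotically ω-periodic
    (∀ s ≥ (0:ℝ), Tendsto
      (fun t => ∫ w, ‖(∫ r in (0:ℝ)..t, U t r (h r)) w -
        (∫ r in (0:ℝ)..s, U s r (h r)) w‖ ^ p ∂μ)
      (nhdsWithin s (Ici 0)) (nhds 0)) ∧
    (∃ C, ∀ t ≥ (0:ℝ), (∫ w, ‖(∫ r in (0:ℝ)..t, U t r (h r)) w‖ ^ p ∂μ) ≤ C) ∧
    Tendsto (fun t => ∫ w, ‖(∫ r in (0:ℝ)..(t + ω), U (t + ω) r (h r)) w -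
        (∫ r in (0:ℝ)..t, U t r (h r)) w‖ ^ p ∂μ)
      atTop (nhds 0) := by
  have hp0 : 0 < p := by linarith
  simp only [integral_norm_sub_rpow_coe_Lp hp0, integral_norm_rpow_coe_Lp hp0,
    tendsto_norm_rpow_zero_iff hp0] at hhcont hhbdd hhper ⊢
  have hU_le : ∀ s t : ℝ, 0 ≤ s → s ≤ t → ‖U t s‖ ≤ M := fun s t hs hst =>
    (hU_bound s t hs hst).trans <| mul_le_of_le_one_right hM.le <|
      Real.exp_le_one_iff.2 (by nlinarith)
  have hk : ContinuousOn h (Ici 0) := fun s hs => tendsto_sub_nhds_zero_iff.1 (hhcont s hs)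
  obtain ⟨D, hD⟩ := hhbdd
  have hC : ∀ t ≥ (0 : ℝ), ‖h t‖ ≤ D ^ p⁻¹ := fun t ht =>
    (Real.le_rpow_inv_iff_of_pos (norm_nonneg _)
      ((Real.rpow_nonneg (norm_nonneg _) p).trans (hD t ht)) hp0).2 (hD t ht)
  refine ⟨fun s hs => ?_, ⟨_, fun t ht => Real.rpow_le_rpow (norm_nonneg _)
    (norm_integral_evolution_apply_le hU_bound hM.le ha hC ht) hp0.le⟩, ?_⟩
  · exact tendsto_sub_nhds_zero_iff.2
      (tendsto_integral_evolution_apply hU_cont hU_le hk hC hs)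
  · exact tendsto_integral_evolution_add_period_sub hω.le hU_cont hU_le hU_bound hU_per
      hM.le ha hk hC hhper
end
end

section
/- Let ω > 0 and let (U(t,s))_{t≥s≥0} be an evolution family of bounded linear operators on a Banach space E satisfying U(t,s)U(s,r) = U(t,r) for r ≤ s ≤ t, U(t,t) = I, and the ω-periodicity U(t+ω, s+ω) = U(t,s) for all t ≥ s. Then for every continuous bounded h : ℝ≥0 → E (such that all the integrals below are Bochner integrable) and every t ≥ 0, the function F(t) = ∫₀ᵗ U(t,s)h(s) ds satisfies the identity F(t+ω) − F(t) = U(t+ω, ω) ∫₀^ω U(ω,s) h(s) ds + ∫₀ᵗ U(t,s)(h(s+ω) − h(s)) ds. -/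
open MeasureTheory Filter Set

noncomputable section

/-- **Decomposition identity.** For an `ω`-periodic evolution family `U` on a Banach
space `E` and a continuous bounded `h : ℝ≥0 → E` (with the relevant Bochner
integrability), the function `F t = ∫₀ᵗ U(t,s) h(s) ds` satisfies
`F(t+ω) − F(t) = U(t+ω,ω) ∫₀^ω U(ω,s) h(s) ds + ∫₀ᵗ U(t,s)(h(s+ω) − h(s)) ds`. -/
theorem evolution_family_convolution_identity
    {E : Type*} [NormedAddCommGroup E] [NormedSpace ℝ E] [CompleteSpace E]
    (ω : ℝ) (hω : 0 < ω)
    -- `U` is an `ω`-periodic evolution family of bounded linear operators on `E`: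
    (U : ℝ → ℝ → (E →L[ℝ] E))
    (hU_comp : ∀ r s t : ℝ, 0 ≤ r → r ≤ s → s ≤ t →
      ∀ x, U t s (U s r x) = U t r x)
    (hU_id : ∀ t : ℝ, 0 ≤ t → ∀ x, U t t x = x)
    (hU_cont : ∀ x : E, Continuous (fun q : ℝ × ℝ => U q.1 q.2 x))
    (hU_per : ∀ s t : ℝ, s ≤ t → U (t + ω) (s + ω) = U t s)
    -- `h` is continuous and bounded on `[0,∞)`:
    (h : ℝ → E)
    (hhcont : ContinuousOn h (Ici 0))
    (hhbdd : ∃ C, ∀ t ≥ (0:ℝ), ‖h t‖ ≤ C)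
    -- Bochner integrability of the integrals involved:
    (hInt1 : ∀ t ≥ (0:ℝ), IntervalIntegrable (fun s => U t s (h s)) volume 0 t)
    (hInt2 : ∀ t ≥ (0:ℝ), IntervalIntegrable (fun s => U t s (h (s + ω))) volume 0 t)
    (t : ℝ) (ht : 0 ≤ t) :
    (∫ s in (0:ℝ)..(t + ω), U (t + ω) s (h s)) - (∫ s in (0:ℝ)..t, U t s (h s)) =
      U (t + ω) ω (∫ s in (0:ℝ)..ω, U ω s (h s)) +
        ∫ s in (0:ℝ)..t, U t s (h (s + ω) - h s) := by
  have htω : 0 ≤ t + ω := by linarith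
  have hInt := hInt1 (t + ω) htω
  have hIntHead : IntervalIntegrable (fun s => U (t + ω) s (h s)) volume 0 ω :=
    hInt.mono_set (uIcc_subset_uIcc_left (by rw [uIcc_of_le htω]; constructor <;> linarith))
  have hIntTail : IntervalIntegrable (fun s => U (t + ω) s (h s)) volume ω (t + ω) :=
    hInt.mono_set (uIcc_subset_uIcc_right (by rw [uIcc_of_le htω]; constructor <;> linarith))
  have hHead : (∫ s in (0:ℝ)..ω, U (t + ω) s (h s)) =
      U (t + ω) ω (∫ s in (0:ℝ)..ω, U ω s (h s)) := by
    rw [← ContinuousLinearMap.intervalIntegral_comp_comm _ (hInt1 ω hω.le)]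
    refine intervalIntegral.integral_congr fun s hs => ?_
    rw [uIcc_of_le hω.le] at hs
    exact (hU_comp s ω (t + ω) hs.1 hs.2 (by linarith) _).symm
  have hTail : (∫ s in ω..(t + ω), U (t + ω) s (h s)) =
      ∫ s in (0:ℝ)..t, U t s (h (s + ω)) := by
    have hshift := intervalIntegral.integral_comp_add_right (a := 0) (b := t)
      (fun s => U (t + ω) s (h s)) ω
    rw [zero_add] at hshift
    rw [← hshift]
    refine intervalIntegral.integral_congr fun s hs => ?_
    rw [uIcc_of_le ht] at hs
    simp only [hU_per s t hs.2]
  simp only [map_sub]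
  rw [intervalIntegral.integral_sub (hInt2 t ht) (hInt1 t ht),
    ← intervalIntegral.integral_add_adjacent_intervals hIntHead hIntTail, hHead, hTail,
    add_sub_assoc]
end
end
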